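/- arXiv:2101.12705 — 3 statements merged into one kernel-verified Lean document; each statement's English description precedes it below -/
import Mathlib

section
/- Every diameter diminishing to zero IFS S = ((X,d),(f_i)_{i∈I}) is uniformly point fibred: there exists a function a : Λ(I) → X (with a_ω the single element of ⋂_{n≥1} closure(f_{[ω]_n}(B)) for any nonempty bounded closed B with F_S(B) ⊆ B) such that for every nonempty bounded closed set B ⊆ X, lim_{n→∞} sup_{ω∈Λ(I)} sup_{x∈B} d(f_{[ω]_n}(x), a_ω) = 0. -/
open Metric Set Filter Bornology

/-- Composition of the maps of an IFS along a finite word: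
`wordComp f [i₁,…,iₙ] = f i₁ ∘ … ∘ f iₙ`. -/
def wordComp {I X : Type*} (f : I → X → X) : List I → X → X
  | [] => id
  | i :: l => f i ∘ wordComp f l

/-- The prefix `[ω]_n` of length `n` of an infinite word `ω ∈ Λ(I) = I^ℕ`. -/
def prefixList {I : Type*} (ω : ℕ → I) (n : ℕ) : List I :=
  List.ofFn fun k : Fin n => ω k

/-- The fractal operator of an IFS: `F_S(B)` is the closure of `⋃ i, f_i(B)`. -/
def fractalOp {I X : Type*} [MetricSpace X] (f : I → X → X) (B : Set X) : Set X :=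
  closure (⋃ i, f i '' B)

/-- The IFS `(f_i)_{i ∈ I}` on `X` is diameter diminishing to zero: every nonempty bounded
closed `B` is contained in a nonempty bounded closed `M_B` invariant under the fractal operator
with `max_{ω ∈ Iⁿ} diam (f_ω(M_B)) → 0`. -/
def IsDDZ {X I : Type*} [MetricSpace X] (f : I → X → X) : Prop :=
  ∀ B : Set X, B.Nonempty → IsBounded B → IsClosed B →
    ∃ M : Set X, M.Nonempty ∧ IsBounded M ∧ IsClosed M ∧ B ⊆ M ∧
      fractalOp f M ⊆ M ∧
      Tendsto (fun n : ℕ => ⨆ ω : Fin n → I, diam (wordComp f (List.ofFn ω) '' M))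
        atTop (nhds 0)

theorem wordComp_append {I X : Type*} (f : I → X → X) (l₁ l₂ : List I) :
    wordComp f (l₁ ++ l₂) = wordComp f l₁ ∘ wordComp f l₂ := by
  induction l₁ with
  | nil => rfl
  | cons i l ih => simp only [List.cons_append, wordComp, ih, Function.comp_assoc]

theorem prefixList_add {I : Type*} (ω : ℕ → I) (n k : ℕ) :
    prefixList ω (n + k) = prefixList ω n ++ prefixList (fun j => ω (n + j)) k := by
  simp [prefixList, List.ofFn_add]

theorem mapsTo_wordComp {I X : Type*} [MetricSpace X] {f : I → X → X} {M : Set X}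
    (hM : fractalOp f M ⊆ M) (l : List I) : MapsTo (wordComp f l) M M := by
  induction l with
  | nil => exact mapsTo_id M
  | cons i l ih =>
    intro x hx
    exact hM (subset_closure (mem_iUnion.2 ⟨i, mem_image_of_mem _ (ih hx)⟩))

theorem wordComp_prefixList_mem_image {I X : Type*} [MetricSpace X] {f : I → X → X} {M : Set X}
    (hM : fractalOp f M ⊆ M) (ω : ℕ → I) {n m : ℕ} (h : n ≤ m) {x : X} (hx : x ∈ M) :
    wordComp f (prefixList ω m) x ∈ wordComp f (prefixList ω n) '' M := by
  obtain ⟨k, rfl⟩ := Nat.exists_eq_add_of_le h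
  rw [prefixList_add, wordComp_append]
  exact mem_image_of_mem _ (mapsTo_wordComp hM _ hx)

theorem dist_le_iSup_diam {I X : Type*} [MetricSpace X] [Finite I] {f : I → X → X} {M : Set X}
    (hM : fractalOp f M ⊆ M) (hb : IsBounded M) (ω : ℕ → I) (n : ℕ) {x y : X}
    (hx : x ∈ closure (wordComp f (prefixList ω n) '' M))
    (hy : y ∈ closure (wordComp f (prefixList ω n) '' M)) :
    dist x y ≤ ⨆ ω : Fin n → I, diam (wordComp f (List.ofFn ω) '' M) := by
  have hb' : IsBounded (wordComp f (prefixList ω n) '' M) :=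
    hb.subset (mapsTo_wordComp hM _).image_subset
  calc dist x y ≤ diam (closure (wordComp f (prefixList ω n) '' M)) :=
        dist_le_diam_of_mem hb'.closure hx hy
    _ = diam (wordComp f (prefixList ω n) '' M) := diam_closure _
    _ ≤ _ := le_ciSup (f := fun ω : Fin n → I => diam (wordComp f (List.ofFn ω) '' M))
        (finite_range _).bddAbove (fun k : Fin n => ω k)

/-- If the orbit of a point of an invariant set `M` along the prefixes of `ω` converges, its limit
lies in the closure of every `f_{[ω]_n}(M)`. -/
theorem mem_closure_image_of_tendsto {I X : Type*} [MetricSpace X] {f : I → X → X} {M : Set X}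
    (hM : fractalOp f M ⊆ M) {ω : ℕ → I} {x y : X} (hx : x ∈ M)
    (h : Tendsto (fun n => wordComp f (prefixList ω n) x) atTop (nhds y)) (n : ℕ) :
    y ∈ closure (wordComp f (prefixList ω n) '' M) :=
  mem_closure_of_tendsto h <| (eventually_ge_atTop n).mono fun _ hm =>
    wordComp_prefixList_mem_image hM ω hm hx

/-- **Proposition 3.2.** Every diameter diminishing to zero IFS is uniformly point fibred:
there is `a : Λ(I) → X` (with `a ω` the single element of `⋂_{n≥1} closure (f_{[ω]_n}(B))`
for any nonempty bounded closed `B` with `F_S(B) ⊆ B`) such that for every nonempty bounded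
closed `B ⊆ X`, `sup_{ω ∈ Λ(I)} sup_{x ∈ B} d(f_{[ω]_n}(x), a ω) → 0`. -/
theorem ddz_uniformly_point_fibred {X I : Type*} [MetricSpace X] [CompleteSpace X] [Nonempty X]
    [Finite I] [Nonempty I] (f : I → X → X)
    (hcont : ∀ i, Continuous (f i))
    (hbdd : ∀ i (B : Set X), IsBounded B → IsBounded (f i '' B))
    (hddz : IsDDZ f) :
    ∃ a : (ℕ → I) → X,
      (∀ (ω : ℕ → I) (B : Set X), B.Nonempty → IsBounded B → IsClosed B →
        fractalOp f B ⊆ B →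
        (⋂ (n : ℕ) (_ : 1 ≤ n), closure (wordComp f (prefixList ω n) '' B)) = {a ω}) ∧
      (∀ B : Set X, B.Nonempty → IsBounded B → IsClosed B →
        Tendsto
          (fun n : ℕ => ⨆ (ω : ℕ → I) (x : X) (_ : x ∈ B),
            dist (wordComp f (prefixList ω n) x) (a ω))
          atTop (nhds 0)) := by
  obtain ⟨x₀⟩ := ‹Nonempty X›
  have hlim : ∀ ω : ℕ → I, ∃ y, Tendsto (fun n => wordComp f (prefixList ω n) x₀) atTop
      (nhds y) := by
    intro ω
    obtain ⟨M, -, hMb, -, hsub, hinv, hD⟩ :=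
      hddz {x₀} (singleton_nonempty _) isBounded_singleton isClosed_singleton
    have hx₀ : x₀ ∈ M := hsub rfl
    exact cauchySeq_tendsto_of_complete <| cauchySeq_of_le_tendsto_0 _
      (fun n m N hn hm => dist_le_iSup_diam hinv hMb ω N
        (subset_closure (wordComp_prefixList_mem_image hinv ω hn hx₀))
        (subset_closure (wordComp_prefixList_mem_image hinv ω hm hx₀))) hD
  choose a ha using hlim
  have key : ∀ B : Set X, IsBounded B → IsClosed B →
      ∃ D : ℕ → ℝ, Tendsto D atTop (nhds 0) ∧ ∀ (ω : ℕ → I) (n : ℕ),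
        ∀ x ∈ closure (wordComp f (prefixList ω n) '' B), dist x (a ω) ≤ D n := by
    intro B hBb hBc
    obtain ⟨M, -, hMb, -, hsub, hinv, hD⟩ :=
      hddz (insert x₀ B) (insert_nonempty _ _) (hBb.insert x₀)
        (by rw [insert_eq]; exact isClosed_singleton.union hBc)
    refine ⟨_, hD, fun ω n x hx => dist_le_iSup_diam hinv hMb ω n ?_ ?_⟩
    · exact closure_mono (image_mono ((subset_insert _ _).trans hsub)) hx
    · exact mem_closure_image_of_tendsto hinv (hsub (mem_insert _ _)) (ha ω) n
  refine ⟨a, fun ω B hBn hBb hBc hB => ?_, fun B hBn hBb hBc => ?_⟩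
  · obtain ⟨D, hD, hdist⟩ := key B hBb hBc
    obtain ⟨b, hb⟩ := hBn
    refine Subset.antisymm (fun y hy => ?_) (singleton_subset_iff.2 ?_)
    · simp only [mem_iInter] at hy
      refine dist_le_zero.1 (ge_of_tendsto hD ?_)
      filter_upwards [eventually_ge_atTop 1] with n hn using hdist ω n y (hy n hn)
    · have hb_lim : Tendsto (fun n => wordComp f (prefixList ω n) b) atTop (nhds (a ω)) :=
        tendsto_iff_dist_tendsto_zero.2 <| squeeze_zero (fun _ => dist_nonneg)
          (fun n => hdist ω n _ (subset_closure (mem_image_of_mem _ hb))) hD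
      exact mem_iInter₂.2 fun n _ => mem_closure_image_of_tendsto hB hb hb_lim n
  · obtain ⟨D, hD, hdist⟩ := key B hBb hBc
    obtain ⟨b, hb⟩ := hBn
    have hle : ∀ (ω : ℕ → I) (n : ℕ), ∀ x ∈ B,
        dist (wordComp f (prefixList ω n) x) (a ω) ≤ D n := fun ω n x hx =>
      hdist ω n _ (subset_closure (mem_image_of_mem _ hx))
    have hD_nonneg : ∀ n, 0 ≤ D n := fun n =>
      dist_nonneg.trans (hle (Classical.arbitrary _) n b hb)
    refine squeeze_zero (fun n => ?_) (fun n => ?_) hD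
    · exact Real.iSup_nonneg fun _ => Real.iSup_nonneg fun _ => Real.iSup_nonneg fun _ =>
        dist_nonneg
    · exact Real.iSup_le (fun ω => Real.iSup_le (fun x => Real.iSup_le (hle ω n x)
        (hD_nonneg n)) (hD_nonneg n)) (hD_nonneg n)
end

section
/- Let S = ((X,d),(f_i)_{i∈I}) be a diameter diminishing to zero IFS and let π : Λ(I) → X be the map π(ω) = a_ω, where a_ω is the single element of ⋂_{n≥1} closure(f_{[ω]_n}(B)) for any nonempty bounded closed B with F_S(B) ⊆ B. Then π is continuous, where Λ(I) = I^{ℕ*} carries the metric d_Λ(ω,θ) = 2^{-min{k : ω_k ≠ θ_k}} (i.e. the product topology with I discrete). -/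
open Metric Set Filter Bornology

/-- A set invariant under the fractal operator is mapped into itself by every word. -/
theorem wordComp_image_subset {I X : Type*} [MetricSpace X] {f : I → X → X} {M : Set X}
    (hM : fractalOp f M ⊆ M) (l : List I) : wordComp f l '' M ⊆ M := by
  induction l with
  | nil => simp [wordComp]
  | cons i l ih =>
    rw [wordComp, image_comp]
    exact (image_mono ih).trans
      ((subset_iUnion (fun i => f i '' M) i).trans (subset_closure.trans hM))

/-- **Proposition 3.4.** For a diameter diminishing to zero IFS, the coding map
`π : Λ(I) → X`, `π(ω) = a_ω` (where `{a_ω} = ⋂_{n≥1} closure (f_{[ω]_n}(B))` for any nonempty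
bounded closed `B` with `F_S(B) ⊆ B`), is continuous, `Λ(I) = I^ℕ` carrying the product
topology with `I` discrete (the topology of the metric `d_Λ`). -/
theorem ddz_pi_continuous {X I : Type*} [MetricSpace X] [CompleteSpace X] [Nonempty X]
    [Finite I] [Nonempty I] [TopologicalSpace I] [DiscreteTopology I] (f : I → X → X)
    (hcont : ∀ i, Continuous (f i))
    (hbdd : ∀ i (B : Set X), IsBounded B → IsBounded (f i '' B))
    (hddz : IsDDZ f)
    (π : (ℕ → I) → X)
    (hπ : ∀ (ω : ℕ → I) (B : Set X), B.Nonempty → IsBounded B → IsClosed B →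
      fractalOp f B ⊆ B →
      (⋂ (n : ℕ) (_ : 1 ≤ n), closure (wordComp f (prefixList ω n) '' B)) = {π ω}) :
    Continuous π := by
  obtain ⟨M, hne, hb, hc, -, hinv, hlim⟩ := hddz {Classical.arbitrary X}
    (singleton_nonempty _) isBounded_singleton isClosed_singleton
  have hmem : ∀ (ω : ℕ → I) (n : ℕ), 1 ≤ n →
      π ω ∈ closure (wordComp f (prefixList ω n) '' M) := by
    intro ω n hn
    have h : π ω ∈ ⋂ (n : ℕ) (_ : 1 ≤ n), closure (wordComp f (prefixList ω n) '' M) := by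
      rw [hπ ω M hne hb hc hinv]
      exact mem_singleton _
    exact mem_iInter₂.mp h n hn
  rw [continuous_iff_continuousAt]
  intro ω
  rw [ContinuousAt, Metric.tendsto_nhds]
  intro ε hε
  obtain ⟨n, hnε, hn⟩ := ((hlim.eventually (gt_mem_nhds hε)).and (eventually_ge_atTop 1)).exists
  have hagree : ∀ᶠ θ in nhds ω, ∀ k : Fin n, θ k = ω k := by
    rw [eventually_all]
    intro k
    exact (continuous_apply (k : ℕ)).continuousAt.eventually
      ((isOpen_discrete {ω k}).mem_nhds (mem_singleton _))
  filter_upwards [hagree] with θ hθ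
  have hpre : prefixList θ n = prefixList ω n := by
    simp only [prefixList, hθ]
  have hθmem := hmem θ n hn
  rw [hpre] at hθmem
  have hbw : IsBounded (wordComp f (prefixList ω n) '' M) :=
    hb.subset (wordComp_image_subset hinv _)
  calc dist (π θ) (π ω)
      ≤ diam (closure (wordComp f (prefixList ω n) '' M)) :=
        dist_le_diam_of_mem hbw.closure hθmem (hmem ω n hn)
    _ = diam (wordComp f (List.ofFn fun k : Fin n => ω k) '' M) := diam_closure _
    _ ≤ ⨆ w : Fin n → I, diam (wordComp f (List.ofFn w) '' M) :=
        le_ciSup (f := fun w : Fin n → I => diam (wordComp f (List.ofFn w) '' M))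
          (finite_range _).bddAbove fun k : Fin n => ω k
    _ < ε := hnε
end

section
/- Let (X,d) be a metric space, I a finite nonempty set, φ a comparison function, and f_i : X → X a φ-contraction for every i ∈ I. Then for every nonempty bounded set B ⊆ X and every n ≥ 1, max_{ω∈I^n} diam(f_ω(B)) ≤ φ^[n](diam(B)); consequently lim_{n→∞} max_{ω∈I^n} diam(f_ω(B)) = 0. -/
open Metric Set Filter Bornology

/-- `φ : [0,∞) → [0,∞)` is a comparison function: increasing, `φ(t) < t` for `t > 0`, and
right-continuous. -/
def IsComparisonFn (φ : ℝ → ℝ) : Prop :=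
  (∀ t : ℝ, 0 ≤ t → 0 ≤ φ t) ∧ MonotoneOn φ (Set.Ici 0) ∧ (∀ t : ℝ, 0 < t → φ t < t) ∧
    ∀ t : ℝ, 0 ≤ t → ContinuousWithinAt φ (Set.Ici t) t

namespace IsComparisonFn

variable {φ : ℝ → ℝ}

theorem map_zero (hφ : IsComparisonFn φ) : φ 0 = 0 := by
  obtain ⟨h0, hm, hlt, -⟩ := hφ
  refine le_antisymm (le_of_forall_pos_le_add fun ε hε => ?_) (h0 0 le_rfl)
  rw [zero_add]
  exact (hm self_mem_Ici hε.le hε.le).trans (hlt ε hε).le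

theorem map_le (hφ : IsComparisonFn φ) {t : ℝ} (ht : 0 ≤ t) : φ t ≤ t := by
  rcases ht.eq_or_lt with rfl | h
  · exact hφ.map_zero.le
  · exact (hφ.2.2.1 t h).le

theorem iterate_nonneg (hφ : IsComparisonFn φ) {t : ℝ} (ht : 0 ≤ t) (n : ℕ) :
    0 ≤ φ^[n] t := by
  induction n with
  | zero => exact ht
  | succ n ih =>
    rw [Function.iterate_succ_apply']
    exact hφ.1 _ ih

theorem tendsto_iterate (hφ : IsComparisonFn φ) {t : ℝ} (ht : 0 ≤ t) :
    Tendsto (fun n => φ^[n] t) atTop (nhds 0) := by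
  have hanti : Antitone fun n => φ^[n] t := antitone_nat_of_succ_le fun n => by
    rw [Function.iterate_succ_apply']
    exact hφ.map_le (hφ.iterate_nonneg ht n)
  have hbdd : BddBelow (range fun n => φ^[n] t) :=
    ⟨0, forall_mem_range.2 (hφ.iterate_nonneg ht)⟩
  have hlim := tendsto_atTop_ciInf hanti hbdd
  set L := ⨅ n, φ^[n] t
  have hL : 0 ≤ L := le_ciInf (hφ.iterate_nonneg ht)
  have hwithin : Tendsto (fun n => φ^[n] t) atTop (nhdsWithin L (Ici L)) :=
    tendsto_nhdsWithin_iff.2 ⟨hlim, Eventually.of_forall fun n => ciInf_le hbdd n⟩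
  have hsucc : Tendsto (fun n => φ^[n + 1] t) atTop (nhds (φ L)) := by
    simpa only [Function.iterate_succ_apply', Function.comp_def] using
      (hφ.2.2.2 L hL).tendsto.comp hwithin
  have hfix : φ L = L := tendsto_nhds_unique hsucc (hlim.comp (tendsto_add_atTop_nat 1))
  rcases hL.eq_or_lt with h | h
  · rwa [← h] at hlim
  · exact absurd hfix (hφ.2.2.1 L h).ne

theorem dist_le_of_contraction {X : Type*} [PseudoMetricSpace X] (hφ : IsComparisonFn φ)
    {g : X → X} (hg : ∀ x y, dist (g x) (g y) ≤ φ (dist x y)) {B : Set X} (hB : IsBounded B) :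
    ∀ x ∈ g '' B, ∀ y ∈ g '' B, dist x y ≤ φ (diam B) := by
  rintro _ ⟨x, hx, rfl⟩ _ ⟨y, hy, rfl⟩
  exact (hg x y).trans (hφ.2.1 dist_nonneg diam_nonneg (dist_le_diam_of_mem hB hx hy))

theorem isBounded_and_diam_wordComp_image_le {X I : Type*} [PseudoMetricSpace X]
    (hφ : IsComparisonFn φ) {f : I → X → X}
    (hf : ∀ (i : I) (x y : X), dist (f i x) (f i y) ≤ φ (dist x y))
    {B : Set X} (hB : IsBounded B) (l : List I) :
    IsBounded (wordComp f l '' B) ∧ diam (wordComp f l '' B) ≤ φ^[l.length] (diam B) := by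
  induction l with
  | nil => simpa [wordComp] using hB
  | cons i l ih =>
    rw [wordComp, image_comp, List.length_cons, Function.iterate_succ_apply']
    have h := hφ.dist_le_of_contraction (hf i) ih.1
    refine ⟨isBounded_iff.2 ⟨_, fun x hx y hy => h x hx y hy⟩, ?_⟩
    exact (diam_le_of_forall_dist_le (hφ.1 _ diam_nonneg) h).trans
      (hφ.2.1 diam_nonneg (hφ.iterate_nonneg diam_nonneg _) ih.2)

end IsComparisonFn

/-- If each `f_i` is a `φ`-contraction for a comparison function `φ`, then for every nonempty
bounded set `B ⊆ X` and every `n ≥ 1`, `max_{ω ∈ Iⁿ} diam (f_ω(B)) ≤ φ^[n] (diam B)`;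
consequently `max_{ω ∈ Iⁿ} diam (f_ω(B)) → 0` as `n → ∞`. -/
theorem diam_word_image_le_iterate {X I : Type*} [MetricSpace X] [Finite I] [Nonempty I]
    (f : I → X → X)
    (φ : ℝ → ℝ) (hφ : IsComparisonFn φ)
    (hcontr : ∀ (i : I) (x y : X), dist (f i x) (f i y) ≤ φ (dist x y)) :
    ∀ B : Set X, B.Nonempty → IsBounded B →
      (∀ n : ℕ, 1 ≤ n →
        (⨆ ω : Fin n → I, diam (wordComp f (List.ofFn ω) '' B)) ≤ φ^[n] (diam B)) ∧
      Tendsto (fun n : ℕ => ⨆ ω : Fin n → I, diam (wordComp f (List.ofFn ω) '' B))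
        atTop (nhds 0) := by
  intro B _ hB
  have hle : ∀ n : ℕ,
      (⨆ ω : Fin n → I, diam (wordComp f (List.ofFn ω) '' B)) ≤ φ^[n] (diam B) := fun n =>
    ciSup_le fun ω => by
      simpa using (hφ.isBounded_and_diam_wordComp_image_le hcontr hB (List.ofFn ω)).2
  exact ⟨fun n _ => hle n, squeeze_zero (fun n => Real.iSup_nonneg fun ω => diam_nonneg) hle
    (hφ.tendsto_iterate diam_nonneg)⟩
end
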